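/- arXiv:1504.04487 — 11 statements merged into one kernel-verified Lean document; each statement's English description precedes it below -/
import Mathlib

section
/- Let $D$ be a nonempty open set in a metric space $(X,\rho)$ with $\partial D \neq \varnothing$, and let $c \geq 2$. Then the function $h_{D,c}(x,y) = \log\left(1 + c\,\rho(x,y)/\sqrt{d_D(x)\,d_D(y)}\right)$ is a metric on $D$; that is, for all $x,y,z \in D$: $h_{D,c}(x,y) \geq 0$ with equality if and only if $x=y$, $h_{D,c}(x,y) = h_{D,c}(y,x)$, and $h_{D,c}(x,y) \leq h_{D,c}(x,z) + h_{D,c}(z,y)$. -/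
/-- The hyperbolic-type distance `h_{D,c}` of an open set `D` in a metric space,
with `d_D(x) = dist(x, ∂D)`. -/
noncomputable def hMetric {X : Type*} [MetricSpace X] (D : Set X) (c : ℝ) (x y : X) : ℝ :=
  Real.log (1 + c * dist x y /
    Real.sqrt (Metric.infDist x (frontier D) * Metric.infDist y (frontier D)))

theorem hMetric_aux_mul (e b q : ℝ) (he : 0 < e) (hb : 0 < b) (hq : 0 ≤ q)
    (h : e ^ 2 - b ^ 2 ≤ q) : e * (e - b) ≤ q := by
  rcases le_total b e with h1 | h1
  · nlinarith
  · nlinarith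

theorem hMetric_aux_tri (a b e p q r c : ℝ) (ha : 0 < a) (hb : 0 < b) (he : 0 < e)
    (hp : 0 ≤ p) (hq : 0 ≤ q) (hr : r ≤ p + q) (hc : 2 ≤ c)
    (h1 : e ^ 2 - b ^ 2 ≤ q) (h2 : e ^ 2 - a ^ 2 ≤ p) :
    1 + c * r / (a * b) ≤ (1 + c * p / (a * e)) * (1 + c * q / (e * b)) := by
  have k1 := mul_le_mul_of_nonneg_left (hMetric_aux_mul e b q he hb hq h1) hp
  have k2 := mul_le_mul_of_nonneg_left (hMetric_aux_mul e a p he ha hp h2) hq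
  have k3 : r * e ^ 2 ≤ (p + q) * e ^ 2 := by gcongr
  have k4 : 2 * (p * q) ≤ c * (p * q) := by gcongr
  have key : 0 ≤ p * e * b + q * e * a + c * (p * q) - r * e ^ 2 := by nlinarith
  have : (1 + c * p / (a * e)) * (1 + c * q / (e * b)) - (1 + c * r / (a * b))
      = c * (p * e * b + q * e * a + c * (p * q) - r * e ^ 2) / (a * b * e ^ 2) := by
    field_simp
    ring
  have : 0 ≤ c * (p * e * b + q * e * a + c * (p * q) - r * e ^ 2) / (a * b * e ^ 2) := by
    have : 0 ≤ c := by linarith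
    positivity
  linarith

/-- For a nonempty open set `D` with nonempty boundary in a metric space and `c ≥ 2`,
`h_{D,c}` is a metric on `D`. -/
theorem hMetric_is_metric {X : Type*} [MetricSpace X] (D : Set X)
    (hD : IsOpen D) (hne : D.Nonempty) (hbd : (frontier D).Nonempty)
    (c : ℝ) (hc : 2 ≤ c) :
    ∀ x ∈ D, ∀ y ∈ D, ∀ z ∈ D,
      (0 ≤ hMetric D c x y) ∧
      (hMetric D c x y = 0 ↔ x = y) ∧
      (hMetric D c x y = hMetric D c y x) ∧
      hMetric D c x y ≤ hMetric D c x z + hMetric D c z y := by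
  have hpos : ∀ x ∈ D, 0 < Metric.infDist x (frontier D) := by
    intro x hx
    refine (isClosed_frontier.notMem_iff_infDist_pos hbd).1 ?_
    intro h
    rw [hD.frontier_eq] at h
    exact h.2 hx
  have hc0 : 0 < c := by linarith
  intro x hx y hy z hz
  have dx := hpos x hx
  have dy := hpos y hy
  have dz := hpos z hz
  have hnn : 0 ≤ c * dist x y /
    Real.sqrt (Metric.infDist x (frontier D) * Metric.infDist y (frontier D)) := by positivity
  refine ⟨Real.log_nonneg (by linarith), ⟨fun h => ?_, fun h => ?_⟩, ?_, ?_⟩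
  · by_contra hxy
    have hd := dist_pos.2 hxy
    have : 0 < c * dist x y /
      Real.sqrt (Metric.infDist x (frontier D) * Metric.infDist y (frontier D)) := by positivity
    have := Real.log_pos (show 1 < 1 + c * dist x y /
      Real.sqrt (Metric.infDist x (frontier D) * Metric.infDist y (frontier D)) by linarith)
    unfold hMetric at h
    linarith
  · subst h
    simp [hMetric]
  · unfold hMetric
    rw [dist_comm, mul_comm (Metric.infDist x _)]
  · unfold hMetric
    rw [← Real.log_mul (by positivity) (by positivity)]
    refine Real.log_le_log (by positivity) ?_
    rw [Real.sqrt_mul dx.le, Real.sqrt_mul dx.le, Real.sqrt_mul dz.le]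
    refine hMetric_aux_tri _ _ _ _ _ _ _ (Real.sqrt_pos.2 dx) (Real.sqrt_pos.2 dy)
      (Real.sqrt_pos.2 dz) dist_nonneg dist_nonneg (dist_triangle x z y) hc ?_ ?_
    · rw [Real.sq_sqrt dz.le, Real.sq_sqrt dy.le]
      have := Metric.infDist_le_infDist_add_dist (s := frontier D) (x := z) (y := y)
      linarith
    · rw [Real.sq_sqrt dz.le, Real.sq_sqrt dx.le]
      have := Metric.infDist_le_infDist_add_dist (s := frontier D) (x := z) (y := x)
      rw [dist_comm z x] at this
      linarith
end

section
/- Let $0 < c < 2$ and let $D = \mathbb{B}^2$ be the open unit disk in $\mathbb{R}^2$. Then there exists $r \in (0,1)$ such that the triangle inequality $h_{D,c}(-r e_1, r e_1) \leq h_{D,c}(-r e_1, 0) + h_{D,c}(0, r e_1)$ fails, where $e_1$ is the first standard basis vector; equivalently, the inequality $\frac{2}{\sqrt{1-r}} + \frac{c r}{1-r} \geq \frac{2}{1-r}$ fails for $r$ sufficiently close to $1$. Hence the constant $2$ in the statement that $h_{D,c}$ is a metric for $c \geq 2$ is best possible. -/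
/-- The `h_{D,c}` function on the open unit disk `𝔹² ⊂ ℝ²`, where the distance
of `x` to the boundary is `1 - ‖x‖`. -/
noncomputable def hDisk (c : ℝ) (x y : EuclideanSpace ℝ (Fin 2)) : ℝ :=
  Real.log (1 + c * dist x y / Real.sqrt ((1 - ‖x‖) * (1 - ‖y‖)))

/-- For `0 < c < 2`, the triangle inequality for `h_{𝔹²,c}` fails at points
`-r e₁, 0, r e₁` for some `r ∈ (0,1)`; hence the constant `2` is best possible. -/
theorem hDisk_not_metric_of_lt_two (c : ℝ) (hc0 : 0 < c) (hc2 : c < 2) :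
    ∃ r ∈ Set.Ioo (0 : ℝ) 1,
      hDisk c (-(r • (EuclideanSpace.single (0 : Fin 2) (1 : ℝ)))) 0 +
        hDisk c 0 (r • (EuclideanSpace.single (0 : Fin 2) (1 : ℝ))) <
      hDisk c (-(r • (EuclideanSpace.single (0 : Fin 2) (1 : ℝ))))
        (r • (EuclideanSpace.single (0 : Fin 2) (1 : ℝ))) := by
  obtain ⟨s, hs⟩ : ∃ s : ℝ, s = (2 - c) / 4 := ⟨_, rfl⟩
  have hs0 : 0 < s := by linarith
  have hs1 : s < 1 := by linarith
  have hr0 : 0 < 1 - s ^ 2 := by nlinarith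
  refine ⟨1 - s ^ 2, ⟨hr0, by nlinarith⟩, ?_⟩
  obtain ⟨r, hr⟩ : ∃ r : ℝ, r = 1 - s ^ 2 := ⟨_, rfl⟩
  rw [← hr] at hr0 ⊢
  have hn : ‖r • (EuclideanSpace.single (0 : Fin 2) (1 : ℝ))‖ = r := by
    rw [norm_smul, EuclideanSpace.norm_single, Real.norm_of_nonneg hr0.le]
    simp
  generalize r • (EuclideanSpace.single (0 : Fin 2) (1 : ℝ)) = v at hn
  have hd : dist (-v) v = 2 * r := by
    rw [dist_eq_norm, show -v - v = (-2 : ℝ) • v by module, norm_smul, hn]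
    norm_num
  have h1 : 1 - r = s ^ 2 := by linarith
  have e1 : Real.sqrt (s ^ 2) = s := Real.sqrt_sq hs0.le
  have e2 : Real.sqrt (s ^ 2 * s ^ 2) = s ^ 2 := Real.sqrt_mul_self (by positivity)
  unfold hDisk
  rw [hd]
  simp only [dist_zero_right, dist_zero_left, norm_neg, norm_zero, sub_zero, mul_one, one_mul,
    hn, h1, e1, e2]
  have hp : 0 < 1 + c * r / s := by positivity
  rw [← Real.log_mul hp.ne' hp.ne']
  apply Real.log_lt_log (by positivity)
  have key : 2 * s + c * r < 2 := by
    have : 0 < c * s ^ 2 := by positivity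
    rw [hr]
    nlinarith
  have : 1 + c * (2 * r) / s ^ 2 - (1 + c * r / s) * (1 + c * r / s)
      = c * r * (2 - (2 * s + c * r)) / s ^ 2 := by
    field_simp
    ring
  have h3 : 0 < c * r * (2 - (2 * s + c * r)) / s ^ 2 := by
    have : 0 < 2 - (2 * s + c * r) := by linarith
    positivity
  linarith
end

section
/- For all $x, y$ in the unit ball $\mathbb{B}^n = \{z \in \mathbb{R}^n : |z| < 1\}$ and every $c > 0$, the following double inequality holds: $\frac{|x-y|}{\sqrt{(1-|x|^2)(1-|y|^2)}} \leq \frac{e^{h_{\mathbb{B}^n,c}(x,y)} - 1}{c} \leq \frac{2|x-y|}{\sqrt{(1-|x|^2)(1-|y|^2)}}$. (The left and right sides equal $\sinh(\rho_{\mathbb{B}^n}(x,y)/2)$ and $2\sinh(\rho_{\mathbb{B}^n}(x,y)/2)$ respectively, where $\rho_{\mathbb{B}^n}$ is the hyperbolic metric of the unit ball.) -/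
/-- The `h_{𝔹ⁿ,c}` function on the unit ball of `ℝⁿ`, where the distance
of `x` to the boundary is `1 - ‖x‖`. -/
noncomputable def hBall {n : ℕ} (c : ℝ) (x y : EuclideanSpace ℝ (Fin n)) : ℝ :=
  Real.log (1 + c * ‖x - y‖ / Real.sqrt ((1 - ‖x‖) * (1 - ‖y‖)))

/-- For `x, y` in the unit ball and `c > 0`:
`sinh(ρ(x,y)/2) ≤ (e^{h_{𝔹ⁿ,c}(x,y)} - 1)/c ≤ 2 sinh(ρ(x,y)/2)`, where
`sinh(ρ(x,y)/2) = |x-y| / √((1-|x|²)(1-|y|²))`. -/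
theorem hBall_exp_bounds {n : ℕ} (c : ℝ) (hc : 0 < c)
    (x y : EuclideanSpace ℝ (Fin n)) (hx : ‖x‖ < 1) (hy : ‖y‖ < 1) :
    ‖x - y‖ / Real.sqrt ((1 - ‖x‖ ^ 2) * (1 - ‖y‖ ^ 2)) ≤
        (Real.exp (hBall c x y) - 1) / c ∧
      (Real.exp (hBall c x y) - 1) / c ≤
        2 * (‖x - y‖ / Real.sqrt ((1 - ‖x‖ ^ 2) * (1 - ‖y‖ ^ 2))) := by
  have ha := norm_nonneg x
  have hb := norm_nonneg y
  have hd := norm_nonneg (x - y)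
  have hE : (Real.exp (hBall c x y) - 1) / c =
      ‖x - y‖ / Real.sqrt ((1 - ‖x‖) * (1 - ‖y‖)) := by
    unfold hBall
    rw [Real.exp_log (by positivity)]
    field_simp
    ring
  rw [hE]
  generalize ‖x - y‖ = d at *
  generalize ‖x‖ = a at *
  generalize ‖y‖ = b at *
  have h1 : 0 < (1 - a) * (1 - b) := mul_pos (by linarith) (by linarith)
  have hab : 0 ≤ a * b := mul_nonneg ha hb
  have hfac : (1 - a ^ 2) * (1 - b ^ 2) = ((1 - a) * (1 - b)) * ((1 + a) * (1 + b)) := by ring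
  have hlow : 1 ≤ (1 + a) * (1 + b) := by nlinarith
  have hup : (1 + a) * (1 + b) ≤ 2 ^ 2 := by nlinarith
  have hS : 0 < Real.sqrt ((1 - a) * (1 - b)) := Real.sqrt_pos.mpr h1
  have hT : 0 < Real.sqrt ((1 - a ^ 2) * (1 - b ^ 2)) := by
    rw [hfac]
    exact Real.sqrt_pos.mpr (mul_pos h1 (by linarith))
  have hST : Real.sqrt ((1 - a) * (1 - b)) ≤ Real.sqrt ((1 - a ^ 2) * (1 - b ^ 2)) := by
    apply Real.sqrt_le_sqrt
    rw [hfac]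
    exact le_mul_of_one_le_right h1.le hlow
  have hTS : Real.sqrt ((1 - a ^ 2) * (1 - b ^ 2)) ≤ 2 * Real.sqrt ((1 - a) * (1 - b)) := by
    rw [Real.sqrt_le_left (by positivity), mul_pow, Real.sq_sqrt h1.le, hfac, mul_comm (2 ^ 2)]
    exact mul_le_mul_of_nonneg_left hup h1.le
  constructor
  · exact div_le_div_of_nonneg_left hd hS hST
  · rw [← mul_div_assoc, div_le_div_iff₀ hS hT]
    nlinarith [mul_le_mul_of_nonneg_left hTS hd]
end

section
/- Let $g : \mathbb{B}^n \to \mathbb{B}^n$ be a map of the unit ball of $\mathbb{R}^n$ into itself that preserves the hyperbolic metric, i.e. $\frac{|g(x)-g(y)|}{\sqrt{(1-|g(x)|^2)(1-|g(y)|^2)}} = \frac{|x-y|}{\sqrt{(1-|x|^2)(1-|y|^2)}}$ for all $x,y \in \mathbb{B}^n$ (as holds for every Möbius transformation of $\mathbb{B}^n$ onto itself). Then for every $c > 0$ and all $x, y \in \mathbb{B}^n$, $h_{\mathbb{B}^n,c}(g(x), g(y)) \leq 2\, h_{\mathbb{B}^n,c}(x,y)$. -/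
theorem hBall_aux (d a b : ℝ) (ha0 : 0 ≤ a) (hb0 : 0 ≤ b) (ha : a < 1) (hb : b < 1) :
    d / Real.sqrt ((1 - a) * (1 - b)) =
      d / Real.sqrt ((1 - a ^ 2) * (1 - b ^ 2)) * Real.sqrt ((1 + a) * (1 + b)) := by
  have h1 : 0 < (1 - a) * (1 - b) := mul_pos (by linarith) (by linarith)
  have h2 : 0 < (1 + a) * (1 + b) := by positivity
  have e : (1 - a ^ 2) * (1 - b ^ 2) = ((1 - a) * (1 - b)) * ((1 + a) * (1 + b)) := by ring
  rw [e, Real.sqrt_mul h1.le]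
  have := Real.sqrt_pos.2 h1
  have := Real.sqrt_pos.2 h2
  field_simp

/-- If `g` maps the unit ball into itself and preserves the hyperbolic metric
(as every Möbius self-transformation of the ball does), then
`h_{𝔹ⁿ,c}(g(x),g(y)) ≤ 2 h_{𝔹ⁿ,c}(x,y)` for all `x, y` in the ball and `c > 0`. -/
theorem hBall_moebius_bound {n : ℕ}
    (g : EuclideanSpace ℝ (Fin n) → EuclideanSpace ℝ (Fin n))
    (hmaps : ∀ x : EuclideanSpace ℝ (Fin n), ‖x‖ < 1 → ‖g x‖ < 1)
    (hiso : ∀ x y : EuclideanSpace ℝ (Fin n), ‖x‖ < 1 → ‖y‖ < 1 →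
      ‖g x - g y‖ / Real.sqrt ((1 - ‖g x‖ ^ 2) * (1 - ‖g y‖ ^ 2)) =
        ‖x - y‖ / Real.sqrt ((1 - ‖x‖ ^ 2) * (1 - ‖y‖ ^ 2)))
    (c : ℝ) (hc : 0 < c)
    (x y : EuclideanSpace ℝ (Fin n)) (hx : ‖x‖ < 1) (hy : ‖y‖ < 1) :
    hBall c (g x) (g y) ≤ 2 * hBall c x y := by
  have hgx := hmaps x hx
  have hgy := hmaps y hy
  unfold hBall
  rw [mul_div_assoc, mul_div_assoc,
    hBall_aux _ _ _ (norm_nonneg (g x)) (norm_nonneg (g y)) hgx hgy,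
    hBall_aux _ _ _ (norm_nonneg x) (norm_nonneg y) hx hy, hiso x y hx hy]
  have hs : 0 ≤ ‖x - y‖ / Real.sqrt ((1 - ‖x‖ ^ 2) * (1 - ‖y‖ ^ 2)) := by positivity
  generalize ‖x - y‖ / Real.sqrt ((1 - ‖x‖ ^ 2) * (1 - ‖y‖ ^ 2)) = s at hs
  have hQ : Real.sqrt ((1 + ‖g x‖) * (1 + ‖g y‖)) ≤ 2 := by
    rw [Real.sqrt_le_left (by norm_num)]
    nlinarith [norm_nonneg (g x), norm_nonneg (g y)]
  have hP : 1 ≤ Real.sqrt ((1 + ‖x‖) * (1 + ‖y‖)) := by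
    rw [Real.one_le_sqrt]
    nlinarith [norm_nonneg x, norm_nonneg y, mul_nonneg (norm_nonneg x) (norm_nonneg y)]
  have hQ0 := Real.sqrt_nonneg ((1 + ‖g x‖) * (1 + ‖g y‖))
  generalize Real.sqrt ((1 + ‖g x‖) * (1 + ‖g y‖)) = Q at hQ hQ0
  generalize Real.sqrt ((1 + ‖x‖) * (1 + ‖y‖)) = P at hP
  have e : 2 * Real.log (1 + c * (s * P)) = Real.log ((1 + c * (s * P)) ^ 2) := by
    rw [Real.log_pow]; norm_num
  rw [e]
  apply Real.log_le_log (by positivity)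
  have hcs : 0 ≤ c * s := by positivity
  have h3 : c * s * Q ≤ c * s * (2 * P) := mul_le_mul_of_nonneg_left (by linarith) hcs
  nlinarith [sq_nonneg (c * (s * P))]
end

section
/- For $c \geq 1/2$ and all $t > 0$, the function $f(t) = \log\left(1 + 2c\sinh(t/2)\right)$ satisfies the double inequality $\frac{c}{2(1+c)}\, t < f(t) < c\, t$. -/
/-- For `c ≥ 1/2` and `t > 0`, the function `f(t) = log(1 + 2c sinh(t/2))`
satisfies `c t / (2(1+c)) < f(t) < c t`. -/
theorem log_sinh_bounds (c : ℝ) (hc : 1 / 2 ≤ c) (t : ℝ) (ht : 0 < t) :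
    c / (2 * (1 + c)) * t < Real.log (1 + 2 * c * Real.sinh (t / 2)) ∧
      Real.log (1 + 2 * c * Real.sinh (t / 2)) < c * t := by
  have hs : 0 < Real.sinh (t / 2) := Real.sinh_pos_iff.2 (by linarith)
  have hch : 1 < Real.cosh (t / 2) := Real.one_lt_cosh.2 (by linarith)
  have he : Real.exp (t / 2) = Real.cosh (t / 2) + Real.sinh (t / 2) :=
    (Real.cosh_add_sinh _).symm
  have hm : Real.cosh (t / 2) - Real.sinh (t / 2) < 1 := by
    rw [Real.cosh_sub_sinh]
    exact Real.exp_lt_one_iff.2 (by linarith)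
  have hc0 : 0 < c := by linarith
  have hpos : 0 < 1 + 2 * c * Real.sinh (t / 2) := by positivity
  have hep := Real.exp_pos (t / 2)
  constructor
  · rw [Real.lt_log_iff_exp_lt hpos]
    have hp1 : c / (1 + c) ≤ 1 := by rw [div_le_one (by linarith)]; linarith
    have hp0 : 0 < c / (1 + c) := by positivity
    have hpc : c / (1 + c) * (1 + c) = c := by field_simp
    have h := rpow_one_add_le_one_add_mul_self (s := Real.exp (t / 2) - 1)
      (by linarith) hp0.le hp1
    rw [add_sub_cancel, ← Real.exp_mul] at h
    have e : c / (2 * (1 + c)) * t = t / 2 * (c / (1 + c)) := by field_simp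
    rw [e]
    refine h.trans_lt ?_
    have h2 : Real.exp (t / 2) - 1 < 2 * (1 + c) * Real.sinh (t / 2) := by nlinarith
    have h3 := mul_lt_mul_of_pos_left h2 hp0
    have h4 : c / (1 + c) * (2 * (1 + c) * Real.sinh (t / 2)) = 2 * c * Real.sinh (t / 2) := by
      field_simp
    linarith
  · rw [Real.log_lt_iff_lt_exp hpos]
    have h := one_add_mul_self_le_rpow_one_add (s := Real.exp (t / 2) - 1)
      (by linarith) (p := 2 * c) (by linarith)
    rw [add_sub_cancel, ← Real.exp_mul] at h
    have e : c * t = t / 2 * (2 * c) := by ring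
    rw [e]
    refine lt_of_lt_of_le ?_ h
    rw [he]
    nlinarith
end

section
/- Let $g : \mathbb{B}^n \to \mathbb{H}^n$ be a map from the unit ball of $\mathbb{R}^n$ to the upper half space $\mathbb{H}^n = \{x \in \mathbb{R}^n : x_n > 0\}$ that is a hyperbolic isometry, i.e. $\frac{|g(x)-g(y)|^2}{g(x)_n\, g(y)_n} = \frac{4|x-y|^2}{(1-|x|^2)(1-|y|^2)}$ for all $x,y \in \mathbb{B}^n$ (as holds for every Möbius transformation of $\mathbb{B}^n$ onto $\mathbb{H}^n$). Then for every $c > 0$ and all $x, y \in \mathbb{B}^n$, $h_{\mathbb{H}^n,c}(g(x), g(y)) \leq 2\, h_{\mathbb{B}^n,c}(x,y)$. -/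
/-- The `h_{ℍⁿ,c}` function on the upper half space
`ℍⁿ = {x : xₙ > 0}` of `ℝⁿ`; the distance of `x` to the boundary is `xₙ`. -/
noncomputable def hHalf {n : ℕ} (c : ℝ) (x y : EuclideanSpace ℝ (Fin (n + 1))) : ℝ :=
  Real.log (1 + c * ‖x - y‖ / Real.sqrt (x (Fin.last n) * y (Fin.last n)))

/-- If `g` maps the unit ball of `ℝⁿ` to the upper half space and is a hyperbolic
isometry (as every Möbius transformation of `𝔹ⁿ` onto `ℍⁿ` is), then
`h_{ℍⁿ,c}(g(x),g(y)) ≤ 2 h_{𝔹ⁿ,c}(x,y)` for all `x, y` in the ball and `c > 0`. -/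
theorem hHalf_moebius_bound {n : ℕ}
    (g : EuclideanSpace ℝ (Fin (n + 1)) → EuclideanSpace ℝ (Fin (n + 1)))
    (hmaps : ∀ x : EuclideanSpace ℝ (Fin (n + 1)), ‖x‖ < 1 → 0 < g x (Fin.last n))
    (hiso : ∀ x y : EuclideanSpace ℝ (Fin (n + 1)), ‖x‖ < 1 → ‖y‖ < 1 →
      ‖g x - g y‖ ^ 2 / (g x (Fin.last n) * g y (Fin.last n)) =
        4 * ‖x - y‖ ^ 2 / ((1 - ‖x‖ ^ 2) * (1 - ‖y‖ ^ 2)))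
    (c : ℝ) (hc : 0 < c)
    (x y : EuclideanSpace ℝ (Fin (n + 1))) (hx : ‖x‖ < 1) (hy : ‖y‖ < 1) :
    hHalf c (g x) (g y) ≤ 2 * hBall c x y := by
  have hA : 0 < g x (Fin.last n) * g y (Fin.last n) := mul_pos (hmaps x hx) (hmaps y hy)
  have hB : 0 < (1 - ‖x‖) * (1 - ‖y‖) := mul_pos (by linarith) (by linarith)
  have hx0 := norm_nonneg x
  have hy0 := norm_nonneg y
  have key : ‖g x - g y‖ / Real.sqrt (g x (Fin.last n) * g y (Fin.last n)) ≤
      2 * (‖x - y‖ / Real.sqrt ((1 - ‖x‖) * (1 - ‖y‖))) := by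
    refine le_of_abs_le (abs_le_of_sq_le_sq ?_ ?_)
    · rw [div_pow, Real.sq_sqrt hA.le, hiso x y hx hy, mul_pow, div_pow, Real.sq_sqrt hB.le,
        ← mul_div_assoc]
      have h1 : (1 - ‖x‖) * (1 - ‖y‖) ≤ (1 - ‖x‖ ^ 2) * (1 - ‖y‖ ^ 2) := by
        apply mul_le_mul <;> nlinarith
      norm_num
      gcongr
    · positivity
  unfold hHalf hBall
  rw [mul_div_assoc, mul_div_assoc]
  set s := ‖g x - g y‖ / Real.sqrt (g x (Fin.last n) * g y (Fin.last n))
  set t := ‖x - y‖ / Real.sqrt ((1 - ‖x‖) * (1 - ‖y‖))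
  have hs : 0 ≤ s := by positivity
  have h2 : 2 * Real.log (1 + c * t) = Real.log ((1 + c * t) ^ 2) := by
    rw [Real.log_pow]; norm_num
  rw [h2]
  apply Real.log_le_log (by positivity)
  nlinarith [mul_le_mul_of_nonneg_left key hc.le, sq_nonneg (c * t)]
end

section
/- For a nonempty open set $D \subsetneq \mathbb{R}^n$ and all $x, y \in D$, the double inequality $\frac{1}{2} j_D(x,y) \leq \varphi_D(x,y) \leq 2\, j_D(x,y)$ holds. -/
/-- The distance ratio metric `j_D` of a proper open subset `D ⊂ ℝⁿ`,
with `d(x) = dist(x, ∂D)`. -/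
noncomputable def jMetric {n : ℕ} (D : Set (EuclideanSpace ℝ (Fin n)))
    (x y : EuclideanSpace ℝ (Fin n)) : ℝ :=
  Real.log (1 + ‖x - y‖ /
    min (Metric.infDist x (frontier D)) (Metric.infDist y (frontier D)))

/-- The function `φ_D` of a proper open subset `D ⊂ ℝⁿ`. -/
noncomputable def phiMetric {n : ℕ} (D : Set (EuclideanSpace ℝ (Fin n)))
    (x y : EuclideanSpace ℝ (Fin n)) : ℝ :=
  Real.log (1 + max
    (‖x - y‖ / Real.sqrt (Metric.infDist x (frontier D) * Metric.infDist y (frontier D)))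
    (‖x - y‖ ^ 2 / (Metric.infDist x (frontier D) * Metric.infDist y (frontier D))))

theorem aux_ineq (a b t : ℝ) (ha : 0 < a) (hab : a ≤ b) (ht : 0 ≤ t) (hb : b ≤ a + t) :
    Real.log (1 + t / a) / 2 ≤
      Real.log (1 + max (t / Real.sqrt (a * b)) (t ^ 2 / (a * b))) ∧
    Real.log (1 + max (t / Real.sqrt (a * b)) (t ^ 2 / (a * b))) ≤
      2 * Real.log (1 + t / a) := by
  have hb0 : 0 < b := lt_of_lt_of_le ha hab
  have hr2 : Real.sqrt (a * b) ^ 2 = a * b := Real.sq_sqrt (by positivity)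
  have hr : 0 < Real.sqrt (a * b) := Real.sqrt_pos.mpr (by positivity)
  set r := Real.sqrt (a * b)
  rw [← hr2]
  have har : a ≤ r := by nlinarith
  have hs : 0 ≤ t / r := by positivity
  have hta : 0 ≤ t / a := by positivity
  have hle : t / r ≤ t / a := div_le_div_of_nonneg_left ht ha har
  have hkey : t / a ≤ t / r + t ^ 2 / r ^ 2 := by
    have e : t / r + t ^ 2 / r ^ 2 = (t * r + t ^ 2) / (a * b) := by
      rw [← hr2]; field_simp
    rw [e, div_le_div_iff₀ ha (by positivity)]
    have h1 : b ≤ r + t := by linarith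
    nlinarith [mul_le_mul_of_nonneg_left h1 (mul_nonneg ht ha.le)]
  have hsq : t ^ 2 / r ^ 2 = (t / r) ^ 2 := by rw [div_pow]
  have hm1 := le_max_left (t / r) (t ^ 2 / r ^ 2)
  have hm2 := le_max_right (t / r) (t ^ 2 / r ^ 2)
  have hm3 : max (t / r) (t ^ 2 / r ^ 2) ≤ 2 * (t / a) + (t / a) ^ 2 := by
    rw [hsq]
    apply max_le <;> nlinarith
  set m := max (t / r) (t ^ 2 / r ^ 2)
  constructor
  · have h : Real.log (1 + t / a) ≤ Real.log ((1 + m) ^ 2) := by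
      apply Real.log_le_log (by positivity)
      nlinarith [sq_nonneg m]
    rw [Real.log_pow] at h
    push_cast at h
    linarith
  · have h : Real.log (1 + m) ≤ Real.log ((1 + t / a) ^ 2) := by
      apply Real.log_le_log (by linarith)
      nlinarith
    rw [Real.log_pow] at h
    push_cast at h
    linarith

/-- For a nonempty proper open set `D ⊊ ℝⁿ` and `x, y ∈ D`:
`j_D(x,y)/2 ≤ φ_D(x,y) ≤ 2 j_D(x,y)`. -/
theorem jMetric_le_phiMetric_le {n : ℕ} (D : Set (EuclideanSpace ℝ (Fin n)))
    (hD : IsOpen D) (hne : D.Nonempty) (hproper : D ≠ Set.univ)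
    (x : EuclideanSpace ℝ (Fin n)) (hx : x ∈ D)
    (y : EuclideanSpace ℝ (Fin n)) (hy : y ∈ D) :
    jMetric D x y / 2 ≤ phiMetric D x y ∧ phiMetric D x y ≤ 2 * jMetric D x y := by
  have hf : (frontier D).Nonempty := nonempty_frontier_iff.mpr ⟨hne, hproper⟩
  have hpos : ∀ z ∈ D, 0 < Metric.infDist z (frontier D) := by
    intro z hz
    refine (isClosed_frontier.notMem_iff_infDist_pos hf).mp ?_
    intro h
    rw [hD.frontier_eq] at h
    exact h.2 hz
  have h1 : Metric.infDist x (frontier D) ≤ Metric.infDist y (frontier D) + ‖x - y‖ := by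
    rw [← dist_eq_norm]; exact Metric.infDist_le_infDist_add_dist
  have h2 : Metric.infDist y (frontier D) ≤ Metric.infDist x (frontier D) + ‖x - y‖ := by
    rw [← dist_eq_norm, dist_comm]; exact Metric.infDist_le_infDist_add_dist
  unfold jMetric phiMetric
  rcases le_total (Metric.infDist x (frontier D)) (Metric.infDist y (frontier D)) with h | h
  · rw [min_eq_left h]
    exact aux_ineq _ _ _ (hpos x hx) h (norm_nonneg _) h2
  · rw [min_eq_right h, mul_comm (Metric.infDist x (frontier D))]
    exact aux_ineq _ _ _ (hpos y hy) h (norm_nonneg _) h1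
end

section
/- For a nonempty open set $D \subsetneq \mathbb{R}^n$ and all $x, y \in D$, the chain of inequalities $\frac{1}{2} j_D(x,y) \leq h_{D,1}(x,y) \leq \varphi_D(x,y) \leq 2\, h_{D,1}(x,y) \leq 2\, j_D(x,y)$ holds. -/
/-- The metric `h_{D,1}` of a proper open subset `D ⊂ ℝⁿ`. -/
noncomputable def hOne {n : ℕ} (D : Set (EuclideanSpace ℝ (Fin n)))
    (x y : EuclideanSpace ℝ (Fin n)) : ℝ :=
  Real.log (1 + ‖x - y‖ /
    Real.sqrt (Metric.infDist x (frontier D) * Metric.infDist y (frontier D)))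

/-- For a nonempty proper open set `D ⊊ ℝⁿ` and `x, y ∈ D`:
`j_D/2 ≤ h_{D,1} ≤ φ_D ≤ 2 h_{D,1} ≤ 2 j_D`. -/
theorem jMetric_hOne_phiMetric_chain {n : ℕ} (D : Set (EuclideanSpace ℝ (Fin n)))
    (hD : IsOpen D) (hne : D.Nonempty) (hproper : D ≠ Set.univ)
    (x : EuclideanSpace ℝ (Fin n)) (hx : x ∈ D)
    (y : EuclideanSpace ℝ (Fin n)) (hy : y ∈ D) :
    jMetric D x y / 2 ≤ hOne D x y ∧
      hOne D x y ≤ phiMetric D x y ∧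
      phiMetric D x y ≤ 2 * hOne D x y ∧
      2 * hOne D x y ≤ 2 * jMetric D x y := by
  have hfne : (frontier D).Nonempty := by
    rw [nonempty_frontier_iff]
    exact ⟨hne, hproper⟩
  have hpos : ∀ z ∈ D, 0 < Metric.infDist z (frontier D) := by
    intro z hz
    refine (isClosed_frontier.notMem_iff_infDist_pos hfne).1 ?_
    intro h
    rw [hD.frontier_eq] at h
    exact h.2 hz
  have ha := hpos x hx
  have hb := hpos y hy
  have h1 : Metric.infDist x (frontier D) ≤ Metric.infDist y (frontier D) + ‖x - y‖ := by
    rw [← dist_eq_norm]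
    exact Metric.infDist_le_infDist_add_dist
  have h2 : Metric.infDist y (frontier D) ≤ Metric.infDist x (frontier D) + ‖x - y‖ := by
    rw [← dist_eq_norm, dist_comm]
    exact Metric.infDist_le_infDist_add_dist
  have ht : 0 ≤ ‖x - y‖ := norm_nonneg _
  unfold jMetric hOne phiMetric
  generalize Metric.infDist x (frontier D) = a at *
  generalize Metric.infDist y (frontier D) = b at *
  generalize ‖x - y‖ = t at *
  have hab : 0 < a * b := mul_pos ha hb
  obtain ⟨s, hs⟩ : ∃ s, s = Real.sqrt (a * b) := ⟨_, rfl⟩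
  have hs0 : 0 < s := hs ▸ Real.sqrt_pos.2 hab
  have hs2 : a * b = s ^ 2 := by rw [hs, Real.sq_sqrt hab.le]
  rw [← hs, hs2]
  obtain ⟨m, hm⟩ : ∃ m, m = min a b := ⟨_, rfl⟩
  obtain ⟨M, hM⟩ : ∃ M, M = max a b := ⟨_, rfl⟩
  have hm0 : 0 < m := hm ▸ lt_min ha hb
  have hmM : m ≤ M := by rw [hm, hM]; exact min_le_max
  have hprod : m * M = s ^ 2 := by rw [hm, hM, min_mul_max, hs2]
  have hMt : M ≤ m + t := by
    rcases le_total a b with h | h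
    · rw [hm, hM, min_eq_left h, max_eq_right h]; exact h2
    · rw [hm, hM, min_eq_right h, max_eq_left h]; exact h1
  rw [← hm]
  have hms : m ≤ s := by nlinarith
  have hu : 0 ≤ t / s := by positivity
  have hsq : t ^ 2 / s ^ 2 = (t / s) ^ 2 := by rw [div_pow]
  have h2log : 2 * Real.log (1 + t / s) = Real.log ((1 + t / s) ^ 2) := by
    rw [Real.log_pow]; norm_num
  rw [hsq]
  refine ⟨?_, ?_, ?_, ?_⟩
  · suffices h : Real.log (1 + t / m) ≤ 2 * Real.log (1 + t / s) by linarith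
    rw [h2log]
    apply Real.log_le_log (by positivity)
    have e1 : t / m = t * M / s ^ 2 := by
      rw [← hprod]
      have : M ≠ 0 := by linarith
      field_simp
    have e2 : (1 + t / s) ^ 2 = 1 + (2 * t * s + t ^ 2) / s ^ 2 := by
      field_simp; ring
    rw [e1, e2]
    gcongr
    nlinarith [mul_nonneg ht (by linarith : 0 ≤ 2 * s + t - M)]
  · apply Real.log_le_log (by positivity)
    gcongr
    exact le_max_left _ _
  · rw [h2log]
    apply Real.log_le_log (by positivity)
    have : max (t / s) ((t / s) ^ 2) ≤ 2 * (t / s) + (t / s) ^ 2 :=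
      max_le (by nlinarith) (by nlinarith)
    nlinarith
  · gcongr
end

section
/- Suppose that for every open interval $I = (a,b) \subset \mathbb{R}$ and all points $p, q, s \in I$ with $p < q < s$, $d_I(p) = |a - p|$ and $d_I(s) = |s - b|$, the triangle inequality $h_I(p,s) \leq h_I(p,q) + h_I(q,s)$ holds, where $h_I(u,v) = \log\left(1 + 2|u-v|/\sqrt{d_I(u)d_I(v)}\right)$ and $d_I(u) = \min\{|u-a|, |u-b|\}$. Then for every metric space $(X,\rho)$, every nonempty open set $D \subset X$, every nonempty set $A \subseteq X \setminus D$, and all $x, y, z \in D$, the triangle inequality $h_D^A(x,y) \leq h_D^A(x,z) + h_D^A(z,y)$ holds. -/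
/-- The function `h_I` of an open interval `I = (a,b) ⊂ ℝ`, with
`d_I(u) = min{|u-a|, |u-b|}`. -/
noncomputable def hInterval (a b u v : ℝ) : ℝ :=
  Real.log (1 + 2 * |u - v| /
    Real.sqrt (min |u - a| |u - b| * min |v - a| |v - b|))

/-- The function `h_D^A` of an open set `D` in a metric space, relative to a set
`A ⊆ X \ D`, with `d_{D,A}(x) = dist(x, A)`. -/
noncomputable def hRel {X : Type*} [MetricSpace X] (A : Set X) (x y : X) : ℝ :=
  Real.log (1 + 2 * dist x y /
    Real.sqrt (Metric.infDist x A * Metric.infDist y A))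

/-- The elementary inequality behind the triangle inequality. -/
lemma hRel_key (a b c r s t : ℝ) (ha : 0 < a) (hb : 0 < b) (hc : 0 < c)
    (hs : 0 ≤ s) (ht : 0 ≤ t) (hr : r ≤ s + t)
    (h1 : c ^ 2 ≤ a ^ 2 + s) (h2 : c ^ 2 ≤ b ^ 2 + t) :
    1 + 2 * r / (a * b) ≤ (1 + 2 * s / (a * c)) * (1 + 2 * t / (c * b)) := by
  have aux : ∀ u v : ℝ, 0 < u → 0 ≤ v → c ^ 2 ≤ u ^ 2 + v → c * (c - u) ≤ v := by
    intro u v hu hv h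
    rcases le_total c u with h' | h'
    · nlinarith
    · nlinarith
  have e1 := mul_le_mul_of_nonneg_left (aux a s ha hs h1) ht
  have e2 := mul_le_mul_of_nonneg_left (aux b t hb ht h2) hs
  have e3 := mul_le_mul_of_nonneg_right hr (sq_nonneg c)
  have key : r * c ^ 2 ≤ c * (s * b + t * a) + 2 * s * t := by nlinarith
  have e : (1 + 2 * s / (a * c)) * (1 + 2 * t / (c * b)) - (1 + 2 * r / (a * b))
      = 2 * (c * (s * b + t * a) + 2 * s * t - r * c ^ 2) / (a * b * c ^ 2) := by
    field_simp
    ring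
  have : 0 ≤ 2 * (c * (s * b + t * a) + 2 * s * t - r * c ^ 2) / (a * b * c ^ 2) := by
    apply div_nonneg
    · linarith
    · positivity
  linarith

/-- If the triangle inequality for `h_I` holds on every open interval `I = (a,b)`
for all points `p < q < s` of `I` with `d_I(p) = |a-p|` and `d_I(s) = |s-b|`, then
for every metric space `(X,ρ)`, nonempty open `D ⊆ X` and nonempty `A ⊆ X \ D`,
the triangle inequality for `h_D^A` holds for all `x, y, z ∈ D`. -/
theorem hRel_triangle_of_interval_triangle
    (hyp : ∀ a b : ℝ, a < b → ∀ p q s : ℝ,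
      a < p → p < q → q < s → s < b →
      min |p - a| |p - b| = |a - p| →
      min |s - a| |s - b| = |s - b| →
      hInterval a b p s ≤ hInterval a b p q + hInterval a b q s) :
    ∀ (X : Type*) [MetricSpace X] (D A : Set X), IsOpen D → D.Nonempty →
      A.Nonempty → A ⊆ Dᶜ →
      ∀ x ∈ D, ∀ y ∈ D, ∀ z ∈ D, hRel A x y ≤ hRel A x z + hRel A z y := by
  intro X _ D A hD _ hA hAD x hx y hy z hz
  have pos : ∀ w ∈ D, 0 < Metric.infDist w A := by
    intro w hw
    obtain ⟨ε, hε, hb⟩ := Metric.isOpen_iff.1 hD w hw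
    refine lt_of_lt_of_le hε ((Metric.le_infDist hA).2 ?_)
    intro v hv
    by_contra hlt
    exact hAD hv (hb (by rw [Metric.mem_ball, dist_comm]; exact not_le.1 hlt))
  have px := pos x hx
  have py := pos y hy
  have pz := pos z hz
  unfold hRel
  rw [← Real.log_mul (by positivity) (by positivity)]
  apply Real.log_le_log (by positivity)
  rw [Real.sqrt_mul px.le, Real.sqrt_mul px.le, Real.sqrt_mul pz.le]
  apply hRel_key _ _ _ _ _ _ (Real.sqrt_pos.2 px) (Real.sqrt_pos.2 py) (Real.sqrt_pos.2 pz)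
    dist_nonneg dist_nonneg (dist_triangle x z y)
  · rw [Real.sq_sqrt px.le, Real.sq_sqrt pz.le, dist_comm]
    exact Metric.infDist_le_infDist_add_dist
  · rw [Real.sq_sqrt py.le, Real.sq_sqrt pz.le]
    exact Metric.infDist_le_infDist_add_dist
end

section
/- Let $c \geq 2$ and let $x, y$ be points of the unit ball $\mathbb{B}^n = \{z \in \mathbb{R}^n : |z| < 1\}$. Then $\frac{1}{c}\, h_{\mathbb{B}^n,c}(x,y) \leq \rho_{\mathbb{B}^n}(x,y) \leq 2\, h_{\mathbb{B}^n,c}(x,y)$, where $\rho_{\mathbb{B}^n}(x,y) = 2\log\frac{|x-y| + A[x,y]}{\sqrt{(1-|x|^2)(1-|y|^2)}}$ with $A[x,y] = \sqrt{|x-y|^2 + (1-|x|^2)(1-|y|^2)}$. -/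
/-- The hyperbolic metric of the unit ball:
`ρ(x,y) = 2 log((|x-y| + A[x,y]) / √((1-|x|²)(1-|y|²)))` where
`A[x,y] = √(|x-y|² + (1-|x|²)(1-|y|²))`. -/
noncomputable def rhoBall {n : ℕ} (x y : EuclideanSpace ℝ (Fin n)) : ℝ :=
  2 * Real.log ((‖x - y‖ +
      Real.sqrt (‖x - y‖ ^ 2 + (1 - ‖x‖ ^ 2) * (1 - ‖y‖ ^ 2))) /
    Real.sqrt ((1 - ‖x‖ ^ 2) * (1 - ‖y‖ ^ 2)))

/-- For `c ≥ 2` and `x, y` in the unit ball: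
`h_{𝔹ⁿ,c}(x,y)/c ≤ ρ_{𝔹ⁿ}(x,y) ≤ 2 h_{𝔹ⁿ,c}(x,y)`. -/
theorem rhoBall_hBall_bounds {n : ℕ} (c : ℝ) (hc : 2 ≤ c)
    (x y : EuclideanSpace ℝ (Fin n)) (hx : ‖x‖ < 1) (hy : ‖y‖ < 1) :
    (1 / c) * hBall c x y ≤ rhoBall x y ∧ rhoBall x y ≤ 2 * hBall c x y := by
  have hx0 := norm_nonneg x
  have hy0 := norm_nonneg y
  have ht := norm_nonneg (x - y)
  unfold hBall rhoBall
  generalize ‖x - y‖ = t at *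
  generalize ‖x‖ = p at *
  generalize ‖y‖ = q at *
  have hP : 0 < (1 - p) * (1 - q) := mul_pos (by linarith) (by linarith)
  have hQ1 : 1 ≤ (1 + p) * (1 + q) := by nlinarith
  have hQ4 : (1 + p) * (1 + q) ≤ 4 := by nlinarith
  have hSe : (1 - p ^ 2) * (1 - q ^ 2) = (1 - p) * (1 - q) * ((1 + p) * (1 + q)) := by ring
  have hS : 0 < (1 - p ^ 2) * (1 - q ^ 2) := by rw [hSe]; positivity
  have hPS : (1 - p) * (1 - q) ≤ (1 - p ^ 2) * (1 - q ^ 2) := by rw [hSe]; nlinarith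
  have hSP : (1 - p ^ 2) * (1 - q ^ 2) ≤ 4 * ((1 - p) * (1 - q)) := by rw [hSe]; nlinarith
  generalize (1 - p ^ 2) * (1 - q ^ 2) = S at *
  generalize (1 - p) * (1 - q) = P at *
  have ha : 0 < √P := Real.sqrt_pos.2 hP
  have hb : 0 < √S := Real.sqrt_pos.2 hS
  have ha2 : √P ^ 2 = P := Real.sq_sqrt hP.le
  have hb2 : √S ^ 2 = S := Real.sq_sqrt hS.le
  have hab : √P ≤ √S := Real.sqrt_le_sqrt hPS
  have hba : √S ≤ 2 * √P := by nlinarith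
  have hA1 : √S ≤ √(t ^ 2 + S) := Real.sqrt_le_sqrt (by nlinarith)
  have hA2 : √(t ^ 2 + S) ≤ t + √S := by
    apply Real.sqrt_le_iff.2
    constructor
    · positivity
    · nlinarith [mul_nonneg ht hb.le]
  generalize √(t ^ 2 + S) = A at *
  generalize √S = b at *
  generalize √P = a at *
  have hlow : 1 + t / b ≤ (t + A) / b := by
    rw [le_div_iff₀ hb, add_mul, div_mul_cancel₀ _ hb.ne']; linarith
  have htb : 0 ≤ t / b := by positivity
  have hta : 0 ≤ t / a := by positivity
  have h1 : t / a ≤ 2 * (t / b) := by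
    rw [← mul_div_assoc, div_le_div_iff₀ ha hb]; nlinarith
  have h2 : t / b ≤ t / a := div_le_div_of_nonneg_left ht ha hab
  have hup : (t + A) / b ≤ 1 + 2 * (t / b) := by
    rw [div_le_iff₀ hb, add_mul, mul_assoc, div_mul_cancel₀ _ hb.ne']; linarith
  rw [mul_div_assoc]
  constructor
  · have hc0 : 0 < c := by linarith
    have e1 : Real.log (1 + c * (t / a)) ≤ c * Real.log (1 + t / a) := by
      rw [← Real.log_rpow (by positivity)]
      exact Real.log_le_log (by positivity)
        (one_add_mul_self_le_rpow_one_add (by linarith) (by linarith))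
    have e2 : Real.log (1 + t / a) ≤ 2 * Real.log ((t + A) / b) := by
      have : (2 : ℝ) * Real.log ((t + A) / b) = Real.log (((t + A) / b) ^ 2) := by
        rw [Real.log_pow]; norm_num
      rw [this]
      exact Real.log_le_log (by positivity) (by nlinarith)
    rw [one_div, inv_mul_le_iff₀ hc0]
    exact e1.trans (mul_le_mul_of_nonneg_left e2 hc0.le)
  · have : Real.log ((t + A) / b) ≤ Real.log (1 + c * (t / a)) :=
      Real.log_le_log (by linarith) (by nlinarith)
    linarith
end

section
/- Let $c \geq 2$ and let $x, y$ be points of the upper half space $\mathbb{H}^n = \{z \in \mathbb{R}^n : z_n > 0\}$. Then $\frac{1}{c}\, h_{\mathbb{H}^n,c}(x,y) \leq \rho_{\mathbb{H}^n}(x,y) \leq 2\, h_{\mathbb{H}^n,c}(x,y)$, where $\rho_{\mathbb{H}^n}(x,y) = \mathrm{arcosh}\left(1 + \frac{|x-y|^2}{2 x_n y_n}\right) = \log\left(u + \sqrt{u^2 - 1}\right)$ with $u = 1 + \frac{|x-y|^2}{2 x_n y_n}$. -/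
/-- The hyperbolic metric of the upper half space:
`ρ(x,y) = arcosh(u) = log(u + √(u² - 1))` with `u = 1 + |x-y|²/(2 xₙ yₙ)`. -/
noncomputable def rhoHalf {n : ℕ} (x y : EuclideanSpace ℝ (Fin (n + 1))) : ℝ :=
  Real.log ((1 + ‖x - y‖ ^ 2 / (2 * x (Fin.last n) * y (Fin.last n))) +
    Real.sqrt ((1 + ‖x - y‖ ^ 2 / (2 * x (Fin.last n) * y (Fin.last n))) ^ 2 - 1))

/-- For `c ≥ 2` and `x, y` in the upper half space:
`h_{ℍⁿ,c}(x,y)/c ≤ ρ_{ℍⁿ}(x,y) ≤ 2 h_{ℍⁿ,c}(x,y)`. -/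
theorem rhoHalf_hHalf_bounds {n : ℕ} (c : ℝ) (hc : 2 ≤ c)
    (x y : EuclideanSpace ℝ (Fin (n + 1)))
    (hx : 0 < x (Fin.last n)) (hy : 0 < y (Fin.last n)) :
    (1 / c) * hHalf c x y ≤ rhoHalf x y ∧ rhoHalf x y ≤ 2 * hHalf c x y := by
  unfold hHalf rhoHalf
  have hp : 0 < x (Fin.last n) * y (Fin.last n) := mul_pos hx hy
  obtain ⟨t, ht⟩ : ∃ t, t = ‖x - y‖ / Real.sqrt (x (Fin.last n) * y (Fin.last n)) := ⟨_, rfl⟩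
  have ht0 : 0 ≤ t := by rw [ht]; positivity
  have h1 : c * ‖x - y‖ / Real.sqrt (x (Fin.last n) * y (Fin.last n)) = c * t := by
    rw [ht, mul_div_assoc]
  have h2 : ‖x - y‖ ^ 2 / (2 * x (Fin.last n) * y (Fin.last n)) = t ^ 2 / 2 := by
    rw [ht, div_pow, Real.sq_sqrt hp.le, div_div]
    congr 1
    ring
  rw [h1, h2]
  have hS1 : t ≤ Real.sqrt ((1 + t ^ 2 / 2) ^ 2 - 1) := by
    apply Real.le_sqrt_of_sq_le
    nlinarith [sq_nonneg (t ^ 2)]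
  have hS2 : Real.sqrt ((1 + t ^ 2 / 2) ^ 2 - 1) ≤ t + t ^ 2 / 2 := by
    apply Real.sqrt_le_iff.mpr
    refine ⟨by positivity, ?_⟩
    nlinarith [pow_nonneg ht0 3]
  have hct : 2 * t ≤ c * t := mul_le_mul_of_nonneg_right hc ht0
  constructor
  · have hb : 1 + c * t ≤ (1 + t) ^ c :=
      one_add_mul_self_le_rpow_one_add (by linarith) (by linarith)
    have hl : Real.log (1 + c * t) ≤ c * Real.log (1 + t) := by
      rw [← Real.log_rpow (by linarith)]
      exact Real.log_le_log (by linarith) hb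
    have hm : Real.log (1 + t) ≤
        Real.log (1 + t ^ 2 / 2 + Real.sqrt ((1 + t ^ 2 / 2) ^ 2 - 1)) :=
      Real.log_le_log (by linarith) (by nlinarith [sq_nonneg t])
    refine le_trans ?_ hm
    rw [one_div, inv_mul_le_iff₀ (by linarith)]
    exact hl
  · have : (2 : ℝ) * Real.log (1 + c * t) = Real.log ((1 + c * t) ^ 2) := by
      rw [Real.log_pow]; norm_num
    rw [this]
    apply Real.log_le_log
    · positivity
    · nlinarith [sq_nonneg t]
end
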